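/- arXiv:2006.07214 — 2 statements merged into one kernel-verified Lean document; each statement's English description precedes it below -/
import Mathlib

section
/- Let α ∈ (1,2], ν a measure on S, φ : S → ℝ^M measurable, U ⊆ ℝ^M open, A : U → ℝ twice differentiable, and p_θ(t) = [(α−1)(θ·φ(t) − A(θ)) + 1]_+^{1/(α−1)} with ∫_S p_θ dν = 1 for all θ ∈ U. Assume that for ν-a.e. t the map θ ↦ p_θ(t) is twice differentiable on U with ∇_θ p_θ(t) = p_θ(t)^{2−α}(φ(t) − ∇A(θ)) and ∇²_θ p_θ(t) = (2−α) p_θ(t)^{3−2α}(φ(t) − ∇A(θ))(φ(t) − ∇A(θ))ᵀ − p_θ(t)^{2−α} ∇²A(θ) (interpreted as 0 where p_θ(t) = 0), that these gradient and Hessian fields are dominated on a ball around θ₀ ∈ U by fixed ν-integrable functions, and that 0 < ∫_{{p_{θ₀}>0}} p_{θ₀}^{2−α} dν < ∞ with p_{θ₀}^{3−2α}‖φ − ∇A(θ₀)‖² ν-integrable. Then ∇²A(θ₀) = (2−α) (∫_{{p_{θ₀}>0}} p_{θ₀}^{3−2α}(φ − ∇A(θ₀))(φ − ∇A(θ₀))ᵀ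 dν) / (∫_{{p_{θ₀}>0}} p_{θ₀}^{2−α} dν), and this matrix is positive semidefinite; in particular A is convex on any convex open set where these hypotheses hold. -/
open Filter Real MeasureTheory
open scoped RealInnerProductSpace

/-- A function differentiable everywhere on an interval, whose derivative is bounded almost
everywhere there, is Lipschitz on that interval. -/
lemma lipschitzOnWith_of_ae_norm_deriv_le {E : Type*} [NormedAddCommGroup E] [NormedSpace ℝ E]
    [CompleteSpace E] {f f' : ℝ → E} {I : Set ℝ} (hI : I.OrdConnected)
    (hf : ∀ s ∈ I, HasDerivAt f (f' s) s) {C : ℝ}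
    (hC : ∀ᵐ s, s ∈ I → ‖f' s‖ ≤ C) : LipschitzOnWith (Real.nnabs C) f I := by
  refine LipschitzOnWith.of_dist_le_mul fun x hx y hy => ?_
  have hsub : Set.uIcc y x ⊆ I := hI.uIcc_subset hy hx
  have hbound : ∀ᵐ s, s ∈ Set.uIoc y x → ‖f' s‖ ≤ C := by
    filter_upwards [hC] with s hs hsx using hs (hsub (Set.uIoc_subset_uIcc hsx))
  have hmeas : AEStronglyMeasurable f' (volume.restrict (Set.uIoc y x)) := by
    refine (aestronglyMeasurable_deriv f _).congr ?_
    filter_upwards [ae_restrict_mem measurableSet_uIoc] with s hs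
      using (hf s (hsub (Set.uIoc_subset_uIcc hs))).deriv
  have hint : IntervalIntegrable f' volume y x := by
    refine (intervalIntegrable_const (c := C)).mono_fun' hmeas ?_
    rwa [EventuallyLE, ae_restrict_iff' measurableSet_uIoc]
  rw [dist_eq_norm, dist_eq_norm,
    ← intervalIntegral.integral_eq_sub_of_hasDerivAt (fun s hs => hf s (hsub hs)) hint]
  refine (intervalIntegral.norm_integral_le_of_norm_le_const_ae hbound).trans ?_
  rw [Real.norm_eq_abs, Real.coe_nnabs]
  gcongr
  exact le_abs_self C

/-- Differentiation under the integral sign when the bound on the derivative holds, for each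
parameter separately, almost everywhere. The integrable weight `w` replaces σ-finiteness of `ν`:
the derivative vanishes off the support of `w`. -/
lemma hasDerivAt_integral_of_forall_ae_norm_deriv_le {S E : Type*} [MeasurableSpace S]
    {ν : Measure S} [NormedAddCommGroup E] [NormedSpace ℝ E] [CompleteSpace E]
    [MeasurableSpace E] [BorelSpace E] [SecondCountableTopology E]
    {F F' : ℝ → S → E} {H : ℝ × S → E} {I : Set ℝ} {x : ℝ} {g : S → ℝ} {w : S → ENNReal}
    (hI : I.OrdConnected) (hIo : IsOpen I) (hx : x ∈ I)
    (hw : Measurable w) (hw_int : ∫⁻ t, w t ∂ν ≠ ⊤)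
    (hF'_zero : ∀ t, w t = 0 → ∀ s ∈ I, F' s t = 0)
    (hH : Measurable H) (hHF' : ∀ s ∈ I, ∀ t, H (s, t) = F' s t)
    (hF_meas : ∀ s ∈ I, AEStronglyMeasurable (F s) ν) (hF_int : Integrable (F x) ν)
    (hg : Integrable g ν) (hbound : ∀ s ∈ I, ∀ᵐ t ∂ν, ‖F' s t‖ ≤ g t)
    (hderiv : ∀ᵐ t ∂ν, ∀ s ∈ I, HasDerivAt (fun r => F r t) (F' s t) s) :
    Integrable (F' x) ν ∧ HasDerivAt (fun s => ∫ t, F s t ∂ν) (∫ t, F' x t ∂ν) x := by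
  have hg0 : ∀ᵐ t ∂ν, 0 ≤ g t := by
    filter_upwards [hbound x hx] with t ht using (norm_nonneg _).trans ht
  have : IsFiniteMeasure (ν.withDensity w) := isFiniteMeasure_withDensity hw_int
  obtain ⟨g', hg'_meas, hgg'⟩ := hg.aemeasurable
  have hset : MeasurableSet {q : ℝ × S | q.1 ∈ I → ‖H q‖ ≤ g' q.2} := by
    have h1 : MeasurableSet {q : ℝ × S | q.1 ∈ I} := measurable_fst hIo.measurableSet
    have h2 : MeasurableSet {q : ℝ × S | ‖H q‖ ≤ g' q.2} :=
      measurableSet_le hH.norm (hg'_meas.comp measurable_snd)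
    exact h1.imp h2
  have hswap : ∀ᵐ t ∂ν.withDensity w, ∀ᵐ s : ℝ, s ∈ I → ‖H (s, t)‖ ≤ g' t := by
    rw [← Measure.ae_ae_comm (p := fun s t => s ∈ I → ‖H (s, t)‖ ≤ g' t) hset]
    refine ae_of_all _ fun s => ?_
    refine (withDensity_absolutelyContinuous ν w).ae_le ?_
    by_cases hs : s ∈ I
    · filter_upwards [hbound s hs, hgg'] with t ht hgt _
      rw [hHF' s hs, ← hgt]
      exact ht
    · exact ae_of_all _ fun t h => absurd h hs
  rw [ae_withDensity_iff hw] at hswap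
  have hlip : ∀ᵐ t ∂ν, LipschitzOnWith (Real.nnabs (g t)) (fun s => F s t) I := by
    filter_upwards [hswap, hgg', hg0, hderiv] with t hts hgt hgt0 hdt
    refine lipschitzOnWith_of_ae_norm_deriv_le hI hdt ?_
    by_cases hwt : w t = 0
    · refine ae_of_all _ fun s hs => ?_
      rw [hF'_zero t hwt s hs, norm_zero]
      exact hgt0
    · filter_upwards [hts hwt] with s hs hsI
      rw [← hHF' s hsI, hgt]
      exact hs hsI
  refine hasDerivAt_integral_of_dominated_loc_of_lip (hIo.mem_nhds hx)
    (eventually_of_mem (hIo.mem_nhds hx) hF_meas) hF_int ?_ hlip hg ?_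
  · have : F' x = fun t => H (x, t) := funext fun t => (hHF' x hx t).symm
    rw [this]
    exact (hH.comp measurable_prodMk_left).aestronglyMeasurable
  · filter_upwards [hderiv] with t ht using ht x hx

/-- A countable family of functions of finite integral has a common weight of finite integral
which vanishes only where all of them do. -/
lemma exists_measurable_lintegral_ne_top_forall_eq_zero {S ι : Type*} [MeasurableSpace S]
    [Countable ι] {ν : Measure S} {f : ι → S → ENNReal} (hf : ∀ i, Measurable (f i))
    (hf_int : ∀ i, ∫⁻ t, f i t ∂ν ≠ ⊤) :
    ∃ w : S → ENNReal, Measurable w ∧ ∫⁻ t, w t ∂ν ≠ ⊤ ∧ ∀ t, w t = 0 → ∀ i, f i t = 0 := by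
  obtain ⟨d, hd, hd_sum⟩ :=
    ENNReal.exists_pos_tsum_mul_lt_of_countable one_ne_zero (fun i => ∫⁻ t, f i t ∂ν) hf_int
  refine ⟨fun t => ∑' i, f i t * d i, by fun_prop, ?_, fun t ht i => ?_⟩
  · rw [lintegral_tsum fun i => by fun_prop]
    simp_rw [lintegral_mul_const _ (hf _)]
    exact (hd_sum.trans ENNReal.one_lt_top).ne
  · have := ENNReal.tsum_eq_zero.1 ht i
    simpa [(hd i).ne'] using this

/-- A twice differentiable function with positive semidefinite Hessian is convex. -/
lemma convexOn_of_hasGradientAt_of_inner_nonneg {E : Type*} [NormedAddCommGroup E]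
    [InnerProductSpace ℝ E] [CompleteSpace E] {V : Set E} (hV : Convex ℝ V)
    {A : E → ℝ} {G : E → E} {HA : E → E →L[ℝ] E}
    (hA : ∀ θ ∈ V, HasGradientAt A (G θ) θ) (hG : ∀ θ ∈ V, HasFDerivAt G (HA θ) θ)
    (hpos : ∀ θ ∈ V, ∀ v, 0 ≤ ⟪HA θ v, v⟫) : ConvexOn ℝ V A := by
  refine ⟨hV, fun x hx y hy a b ha hb hab => ?_⟩
  have hmem : ∀ s ∈ Set.Icc (0 : ℝ) 1, x + s • (y - x) ∈ V := fun s hs =>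
    hV.add_smul_sub_mem hx hy hs
  have hline : ∀ s : ℝ, HasDerivAt (fun r : ℝ => x + r • (y - x)) (y - x) s := fun s => by
    simpa using ((hasDerivAt_id s).smul_const (y - x)).const_add x
  have h1 : ∀ s ∈ Set.Icc (0 : ℝ) 1, HasDerivAt (fun r : ℝ => A (x + r • (y - x)))
      ⟪G (x + s • (y - x)), y - x⟫ s := fun s hs => by
    simpa [Function.comp_def] using (hA _ (hmem s hs)).hasFDerivAt.comp_hasDerivAt s (hline s)
  have h2 : ∀ s ∈ Set.Icc (0 : ℝ) 1, HasDerivAt (fun r : ℝ => ⟪G (x + r • (y - x)), y - x⟫)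
      ⟪HA (x + s • (y - x)) (y - x), y - x⟫ s := fun s hs => by
    simpa using ((hG _ (hmem s hs)).comp_hasDerivAt s (hline s)).inner ℝ
      (hasDerivAt_const s (y - x))
  have hconv : ConvexOn ℝ (Set.Icc (0 : ℝ) 1) fun r : ℝ => A (x + r • (y - x)) := by
    refine convexOn_of_hasDerivWithinAt2_nonneg (convex_Icc 0 1)
      (fun s hs => (h1 s hs).continuousAt.continuousWithinAt)
      (fun s hs => (h1 s (interior_subset hs)).hasDerivWithinAt)
      (fun s hs => (h2 s (interior_subset hs)).hasDerivWithinAt)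
      (fun s hs => hpos _ (hmem s (interior_subset hs)) _)
  have := hconv.2 (Set.left_mem_Icc.2 zero_le_one) (Set.right_mem_Icc.2 zero_le_one) ha hb hab
  have hxy : x + b • (y - x) = a • x + b • y := by
    rw [← eq_sub_iff_add_eq] at hab
    rw [hab]
    module
  simpa [hxy] using this

/-- The Hessian of the normalizing function `A` of an α-sparse family equals
`(2−α)` times the (escort-normalized) second moment of `φ − ∇A`, it is positive
semidefinite, and in particular `A` is convex on any convex open subset of `U`. -/
theorem stmt_6 {S : Type*} [MeasurableSpace S] (ν : Measure S)
    (α : ℝ) (hα1 : 1 < α) (hα2 : α ≤ 2) (M : ℕ)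
    (φ : S → EuclideanSpace ℝ (Fin M)) (hφ : Measurable φ)
    (U : Set (EuclideanSpace ℝ (Fin M))) (hU : IsOpen U)
    (A : EuclideanSpace ℝ (Fin M) → ℝ)
    -- G is the gradient of A and HA its Hessian (A is twice differentiable on U)
    (G : EuclideanSpace ℝ (Fin M) → EuclideanSpace ℝ (Fin M))
    (HA : EuclideanSpace ℝ (Fin M) →
      (EuclideanSpace ℝ (Fin M) →L[ℝ] EuclideanSpace ℝ (Fin M)))
    (hA : ∀ θ ∈ U, HasGradientAt A (G θ) θ)
    (hA2 : ∀ θ ∈ U, HasFDerivAt G (HA θ) θ)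
    (p : EuclideanSpace ℝ (Fin M) → S → ℝ)
    (hp : ∀ θ t, p θ t = max ((α - 1) * (⟪θ, φ t⟫ - A θ) + 1) 0 ^ (1 / (α - 1)))
    (hp_one : ∀ θ ∈ U, ∫ t, p θ t ∂ν = 1)
    -- gradient and Hessian fields of θ ↦ p_θ(t), interpreted as 0 where p_θ(t) = 0
    (gradp : EuclideanSpace ℝ (Fin M) → S → EuclideanSpace ℝ (Fin M))
    (hgradp : ∀ θ t, gradp θ t =
      if p θ t = 0 then 0 else (p θ t ^ (2 - α)) • (φ t - G θ))
    (hessp : EuclideanSpace ℝ (Fin M) → S →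
      (EuclideanSpace ℝ (Fin M) →L[ℝ] EuclideanSpace ℝ (Fin M)))
    (hhessp : ∀ θ t v, hessp θ t v =
      if p θ t = 0 then 0 else
        ((2 - α) * p θ t ^ (3 - 2 * α) * ⟪φ t - G θ, v⟫) • (φ t - G θ) -
          (p θ t ^ (2 - α)) • (HA θ v))
    (hdiff : ∀ᵐ t ∂ν, ∀ θ ∈ U,
      HasGradientAt (fun θ' => p θ' t) (gradp θ t) θ ∧
        HasFDerivAt (fun θ' => gradp θ' t) (hessp θ t) θ)
    -- domination of the gradient and Hessian fields near each point of U
    (hdom : ∀ θ₀ ∈ U, ∃ ε > 0, Metric.ball θ₀ ε ⊆ U ∧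
      ∃ g₁ g₂ : S → ℝ, Integrable g₁ ν ∧ Integrable g₂ ν ∧
        ∀ θ ∈ Metric.ball θ₀ ε, ∀ᵐ t ∂ν, ‖gradp θ t‖ ≤ g₁ t ∧ ‖hessp θ t‖ ≤ g₂ t)
    (hZ : ∀ θ₀ ∈ U, IntegrableOn (fun t => p θ₀ t ^ (2 - α)) {t | 0 < p θ₀ t} ν)
    (hZpos : ∀ θ₀ ∈ U, 0 < ∫ t in {t | 0 < p θ₀ t}, p θ₀ t ^ (2 - α) ∂ν)
    (hmom : ∀ θ₀ ∈ U, IntegrableOn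
      (fun t => p θ₀ t ^ (3 - 2 * α) * ‖φ t - G θ₀‖ ^ 2) {t | 0 < p θ₀ t} ν) :
    (∀ θ₀ ∈ U,
      (∀ v, HA θ₀ v =
        ((2 - α) / ∫ t in {t | 0 < p θ₀ t}, p θ₀ t ^ (2 - α) ∂ν) •
          (∫ t in {t | 0 < p θ₀ t},
            (p θ₀ t ^ (3 - 2 * α) * ⟪φ t - G θ₀, v⟫) • (φ t - G θ₀) ∂ν)) ∧
      (∀ v, 0 ≤ ⟪HA θ₀ v, v⟫)) ∧
    ∀ V : Set (EuclideanSpace ℝ (Fin M)),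
      Convex ℝ V → IsOpen V → V ⊆ U → ConvexOn ℝ V A := by
  have hα : 0 < α - 1 := by linarith
  have hA_cont : ContinuousOn A U := fun θ hθ =>
    (hA θ hθ).hasFDerivAt.continuousAt.continuousWithinAt
  have hG_cont : ContinuousOn G U := fun θ hθ => (hA2 θ hθ).continuousAt.continuousWithinAt
  have hp_nonneg : ∀ θ t, 0 ≤ p θ t := fun θ t => by
    rw [hp]
    positivity
  have hp_meas : ∀ θ, Measurable (p θ) := fun θ => by
    rw [show p θ = _ from funext (hp θ)]
    fun_prop
  have hp_int : ∀ θ ∈ U, Integrable (p θ) ν := fun θ hθ => by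
    by_contra h
    simpa [integral_undef h] using hp_one θ hθ
  have hgradp_meas : ∀ θ, Measurable (gradp θ) := fun θ => by
    rw [show gradp θ = _ from funext (hgradp θ)]
    exact Measurable.ite (hp_meas θ (measurableSet_singleton 0)) measurable_const
      (((hp_meas θ).pow_const _).smul (hφ.sub_const _))
  -- a single weight of finite integral whose support contains that of every `p θ`
  obtain ⟨w, hw_meas, hw_int, hw⟩ : ∃ w : S → ENNReal, Measurable w ∧ ∫⁻ t, w t ∂ν ≠ ⊤ ∧
      ∀ t, w t = 0 → ∀ θ ∈ U, p θ t = 0 := by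
    obtain ⟨D, hD_count, hD⟩ := TopologicalSpace.exists_countable_dense U
    have : Countable D := hD_count
    obtain ⟨w, hw_meas, hw_int, hw⟩ := exists_measurable_lintegral_ne_top_forall_eq_zero
      (ν := ν) (f := fun (θ : D) t => ENNReal.ofReal (p θ t))
      (fun θ => (hp_meas _).ennreal_ofReal)
      (fun θ => (hp_int θ.1 θ.1.2).lintegral_lt_top.ne)
    refine ⟨w, hw_meas, hw_int, fun t ht θ hθ => ?_⟩
    have hcont : Continuous fun θ : U => p θ t := by
      have hAU : Continuous fun θ : U => A θ := continuousOn_iff_continuous_domRestrict.1 hA_cont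
      have hφU : Continuous fun θ : U => ⟪(θ : EuclideanSpace ℝ (Fin M)), φ t⟫ := by fun_prop
      simp_rw [hp]
      exact ((((hφU.sub hAU).const_mul _).add_const _).max continuous_const).rpow_const
        fun _ => Or.inr (by positivity)
    have hzero : Set.EqOn (fun θ : U => p θ t) (fun _ => 0) D := fun θ hθD =>
      le_antisymm (by simpa using hw t ht ⟨θ, hθD⟩) (hp_nonneg _ _)
    exact congrFun (hcont.ext_on hD continuous_const hzero) ⟨θ, hθ⟩
  -- jointly measurable versions of the fields
  classical
  have hA1 : Measurable (U.piecewise A fun _ => 0) :=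
    hA_cont.measurable_piecewise continuousOn_const hU.measurableSet
  have hG1 : Measurable (U.piecewise G fun _ => 0) :=
    hG_cont.measurable_piecewise continuousOn_const hU.measurableSet
  set P : EuclideanSpace ℝ (Fin M) × S → ℝ := fun q =>
    max ((α - 1) * (⟪q.1, φ q.2⟫ - U.piecewise A (fun _ => 0) q.1) + 1) 0 ^ (1 / (α - 1)) with hP
  set Φ : EuclideanSpace ℝ (Fin M) × S → EuclideanSpace ℝ (Fin M) := fun q =>
    φ q.2 - U.piecewise G (fun _ => 0) q.1 with hΦ
  have hP_meas : Measurable P := by fun_prop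
  have hΦ_meas : Measurable Φ := by fun_prop
  have hPp : ∀ θ ∈ U, ∀ t, P (θ, t) = p θ t := fun θ hθ t => by simp [hP, hp, hθ]
  have hΦφ : ∀ θ ∈ U, ∀ t, Φ (θ, t) = φ t - G θ := fun θ hθ t => by simp [hΦ, hθ]
  have hP0 : MeasurableSet {q | P q = 0} := hP_meas (measurableSet_singleton 0)
  obtain ⟨K, hK_meas, hK⟩ : ∃ K : EuclideanSpace ℝ (Fin M) × S → EuclideanSpace ℝ (Fin M),
      Measurable K ∧ ∀ θ ∈ U, ∀ t, K (θ, t) = gradp θ t :=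
    ⟨fun q => if P q = 0 then 0 else P q ^ (2 - α) • Φ q,
      Measurable.ite hP0 measurable_const ((hP_meas.pow_const _).smul hΦ_meas),
      fun θ hθ t => by simp only [hPp θ hθ, hΦφ θ hθ, hgradp]⟩
  have hL : ∀ v, ∃ L : EuclideanSpace ℝ (Fin M) × S → EuclideanSpace ℝ (Fin M),
      Measurable L ∧ ∀ θ ∈ U, ∀ t, L (θ, t) = hessp θ t v := fun v => by
    have hHA : Measurable fun θ => fderiv ℝ G θ v := measurable_fderiv_apply_const ℝ G v
    refine ⟨fun q => if P q = 0 then 0 else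
      ((2 - α) * P q ^ (3 - 2 * α) * ⟪Φ q, v⟫) • Φ q - P q ^ (2 - α) • fderiv ℝ G q.1 v,
      Measurable.ite hP0 measurable_const ?_, fun θ hθ t => ?_⟩
    · exact ((((hP_meas.pow_const _).const_mul _).mul (hΦ_meas.inner measurable_const)).smul
        hΦ_meas).sub ((hP_meas.pow_const _).smul (hHA.comp measurable_fst))
    · simp only [hPp θ hθ, hΦφ θ hθ, hhessp, (hA2 θ hθ).fderiv]
  have hline : ∀ (θ v : EuclideanSpace ℝ (Fin M)) (s : ℝ),
      HasDerivAt (fun r : ℝ => θ + r • v) v s := fun θ v s => by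
    simpa using ((hasDerivAt_id s).smul_const v).const_add θ
  have hline_meas : ∀ θ v : EuclideanSpace ℝ (Fin M),
      Measurable fun q : ℝ × S => (θ + q.1 • v, q.2) := fun θ v => by fun_prop
  have hsegment : ∀ (θ : EuclideanSpace ℝ (Fin M)) (v : EuclideanSpace ℝ (Fin M)) (ε : ℝ), 0 < ε →
      ∃ δ : ℝ, 0 < δ ∧ ∀ s ∈ Set.Ioo (-δ) δ, θ + s • v ∈ Metric.ball θ ε := fun θ v ε hε => by
    have hc : ContinuousAt (fun r : ℝ => θ + r • v) 0 := (hline θ v 0).continuousAt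
    obtain ⟨δ, hδ, h⟩ := Metric.continuousAt_iff.1 hc ε hε
    refine ⟨δ, hδ, fun s hs => ?_⟩
    simpa using h (x := s) (by simpa [abs_lt] using hs)
  have hgradp_int : ∀ θ ∈ U, Integrable (gradp θ) ν := fun θ hθ => by
    obtain ⟨ε, hε, -, g₁, g₂, hg₁, -, hb⟩ := hdom θ hθ
    refine hg₁.mono' (hgradp_meas θ).aestronglyMeasurable ?_
    filter_upwards [hb θ (Metric.mem_ball_self hε)] with t ht using ht.1
  have hgrad_zero : ∀ θ ∈ U, ∫ t, gradp θ t ∂ν = 0 := fun θ hθ => by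
    refine ext_inner_left ℝ fun v => ?_
    obtain ⟨ε, hε, hball, g₁, g₂, hg₁, -, hb⟩ := hdom θ hθ
    obtain ⟨δ, hδ, hseg⟩ := hsegment θ v ε hε
    have hsegU : ∀ s ∈ Set.Ioo (-δ) δ, θ + s • v ∈ U := fun s hs => hball (hseg s hs)
    have h0 : (0 : ℝ) ∈ Set.Ioo (-δ) δ := by simp [hδ]
    obtain ⟨-, hd⟩ := hasDerivAt_integral_of_forall_ae_norm_deriv_le (ν := ν)
      (F := fun s => p (θ + s • v)) (F' := fun s t => ⟪v, gradp (θ + s • v) t⟫)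
      (H := fun q => ⟪v, K (θ + q.1 • v, q.2)⟫) (g := fun t => ‖v‖ * g₁ t) (x := 0)
      Set.ordConnected_Ioo isOpen_Ioo h0 hw_meas hw_int
      (fun t ht s hs => by simp [hgradp, hw t ht _ (hsegU s hs)])
      (measurable_const.inner (hK_meas.comp (hline_meas θ v)))
      (fun s hs t => by rw [hK _ (hsegU s hs)])
      (fun s _ => (hp_meas _).aestronglyMeasurable) (by simpa using hp_int θ hθ)
      (hg₁.const_mul _)
      (fun s hs => by
        filter_upwards [hb _ (hseg s hs)] with t ht
        exact (norm_inner_le_norm _ _).trans (by gcongr; exact ht.1))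
      (by
        filter_upwards [hdiff] with t ht s hs
        simpa [Function.comp_def, real_inner_comm] using
          (ht _ (hsegU s hs)).1.hasFDerivAt.comp_hasDerivAt s (hline θ v s))
    have hconst : HasDerivAt (fun s : ℝ => ∫ t, p (θ + s • v) t ∂ν) 0 0 :=
      (hasDerivAt_const (0 : ℝ) (1 : ℝ)).congr_of_eventuallyEq <|
        eventually_of_mem (isOpen_Ioo.mem_nhds h0) fun s hs => hp_one _ (hsegU s hs)
    have := hd.unique hconst
    simp only [zero_smul, add_zero] at this
    rw [inner_zero_right, ← this, integral_inner (hgradp_int θ hθ)]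
  have hhess_zero : ∀ θ ∈ U, ∀ v, ∫ t, hessp θ t v ∂ν = 0 := fun θ hθ v => by
    obtain ⟨ε, hε, hball, g₁, g₂, -, hg₂, hb⟩ := hdom θ hθ
    obtain ⟨δ, hδ, hseg⟩ := hsegment θ v ε hε
    have hsegU : ∀ s ∈ Set.Ioo (-δ) δ, θ + s • v ∈ U := fun s hs => hball (hseg s hs)
    have h0 : (0 : ℝ) ∈ Set.Ioo (-δ) δ := by simp [hδ]
    obtain ⟨L, hL_meas, hL⟩ := hL v
    obtain ⟨-, hd⟩ := hasDerivAt_integral_of_forall_ae_norm_deriv_le (ν := ν)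
      (F := fun s => gradp (θ + s • v)) (F' := fun s t => hessp (θ + s • v) t v)
      (H := fun q => L (θ + q.1 • v, q.2)) (g := fun t => g₂ t * ‖v‖) (x := 0)
      Set.ordConnected_Ioo isOpen_Ioo h0 hw_meas hw_int
      (fun t ht s hs => by simp [hhessp, hw t ht _ (hsegU s hs)])
      (hL_meas.comp (hline_meas θ v))
      (fun s hs t => hL _ (hsegU s hs) t)
      (fun s _ => (hgradp_meas _).aestronglyMeasurable) (by simpa using hgradp_int θ hθ)
      (hg₂.mul_const _)
      (fun s hs => by
        filter_upwards [hb _ (hseg s hs)] with t ht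
        exact (ContinuousLinearMap.le_opNorm _ _).trans (by gcongr; exact ht.2))
      (by
        filter_upwards [hdiff] with t ht s hs
        exact (ht _ (hsegU s hs)).2.comp_hasDerivAt s (hline θ v s))
    have hconst : HasDerivAt (fun s : ℝ => ∫ t, gradp (θ + s • v) t ∂ν) 0 0 :=
      (hasDerivAt_const (0 : ℝ) (0 : EuclideanSpace ℝ (Fin M))).congr_of_eventuallyEq <|
        eventually_of_mem (isOpen_Ioo.mem_nhds h0) fun s hs => hgrad_zero _ (hsegU s hs)
    simpa using hd.unique hconst
  have hX_int : ∀ θ ∈ U, ∀ v, IntegrableOn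
      (fun t => (p θ t ^ (3 - 2 * α) * ⟪φ t - G θ, v⟫) • (φ t - G θ)) {t | 0 < p θ t} ν :=
    fun θ hθ v => by
    refine ((hmom θ hθ).mul_const ‖v‖).mono' ?_ (ae_of_all _ fun t => ?_)
    · exact ((((hp_meas θ).pow_const _).mul ((hφ.sub_const _).inner measurable_const)).smul
        (hφ.sub_const _)).aestronglyMeasurable
    · have h3 : 0 ≤ p θ t ^ (3 - 2 * α) := rpow_nonneg (hp_nonneg θ t) _
      rw [norm_smul, norm_mul, Real.norm_of_nonneg h3]
      calc p θ t ^ (3 - 2 * α) * ‖⟪φ t - G θ, v⟫‖ * ‖φ t - G θ‖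
          ≤ p θ t ^ (3 - 2 * α) * (‖φ t - G θ‖ * ‖v‖) * ‖φ t - G θ‖ := by
            gcongr
            exact norm_inner_le_norm _ _
        _ = p θ t ^ (3 - 2 * α) * ‖φ t - G θ‖ ^ 2 * ‖v‖ := by ring
  have hformula : ∀ θ ∈ U, ∀ v, HA θ v =
      ((2 - α) / ∫ t in {t | 0 < p θ t}, p θ t ^ (2 - α) ∂ν) •
        ∫ t in {t | 0 < p θ t}, (p θ t ^ (3 - 2 * α) * ⟪φ t - G θ, v⟫) • (φ t - G θ) ∂ν :=
    fun θ hθ v => by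
    have hsupp : MeasurableSet {t | 0 < p θ t} := measurableSet_lt measurable_const (hp_meas θ)
    have hrestrict : ∫ t in {t | 0 < p θ t}, hessp θ t v ∂ν = 0 := by
      rw [setIntegral_eq_integral_of_forall_compl_eq_zero, hhess_zero θ hθ v]
      intro t ht
      have : p θ t = 0 := le_antisymm (not_lt.1 ht) (hp_nonneg θ t)
      simp [hhessp, this]
    have hsplit : ∫ t in {t | 0 < p θ t}, hessp θ t v ∂ν =
        ∫ t in {t | 0 < p θ t},
          ((2 - α) • ((p θ t ^ (3 - 2 * α) * ⟪φ t - G θ, v⟫) • (φ t - G θ)) -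
            p θ t ^ (2 - α) • HA θ v) ∂ν := by
      refine setIntegral_congr_fun hsupp fun t ht => ?_
      have : p θ t ≠ 0 := ne_of_gt ht
      simp only [hhessp, this, if_false, smul_smul, mul_assoc]
    rw [hsplit, integral_sub ((hX_int θ hθ v).integrable.fun_smul (2 - α)) ((hZ θ hθ).smul_const _),
      integral_smul, integral_smul_const, sub_eq_zero] at hrestrict
    rw [div_eq_inv_mul, mul_smul, hrestrict, inv_smul_smul₀ (hZpos θ hθ).ne']
  have hpos : ∀ θ ∈ U, ∀ v, 0 ≤ ⟪HA θ v, v⟫ := fun θ hθ v => by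
    rw [hformula θ hθ v, real_inner_smul_left, real_inner_comm, ← integral_inner (hX_int θ hθ v)]
    refine mul_nonneg (div_nonneg (by linarith) (hZpos θ hθ).le) (integral_nonneg fun t => ?_)
    have h3 : 0 ≤ p θ t ^ (3 - 2 * α) := rpow_nonneg (hp_nonneg θ t) _
    simp only [Pi.zero_apply, real_inner_smul_right, real_inner_comm v, mul_assoc]
    exact mul_nonneg h3 (mul_self_nonneg _)
  exact ⟨fun θ hθ => ⟨hformula θ hθ, hpos θ hθ⟩, fun V hV _ hVU =>
    convexOn_of_hasGradientAt_of_inner_nonneg hV (fun θ hθ => hA θ (hVU hθ))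
      (fun θ hθ => hA2 θ (hVU hθ)) fun θ hθ => hpos θ (hVU hθ)⟩
end

section
/- Let Σ and Σⱼ be positive definite D×D real matrices and μ, μⱼ ∈ ℝ^D, and let p(t) = N_D(t; μ, Σ) and ψ(t) = N_D(t; μⱼ, Σⱼ). Set s̃ = N_D(μ; μⱼ, Σ + Σⱼ), Σ̃ = (Σ⁻¹ + Σⱼ⁻¹)⁻¹, and μ̃ = Σ̃(Σ⁻¹μ + Σⱼ⁻¹μⱼ). Then ∫_{ℝ^D} t · p(t)ψ(t) dt − (∫_{ℝ^D} t · p(t) dt)(∫_{ℝ^D} p(t)ψ(t) dt) = s̃ (μ̃ − μ); i.e. the covariance cov_p(t, ψ(t)) under p equals s̃(μ̃ − μ). -/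
open Real Matrix

/-- The `D`-dimensional Gaussian density
`N_D(x; μ, Σ) = (2π)^(−D/2) (det Σ)^(−1/2) exp(−(1/2)(x−μ)ᵀΣ⁻¹(x−μ))`. -/
noncomputable def gaussDensity {D : ℕ} (μ : Fin D → ℝ) (C : Matrix (Fin D) (Fin D) ℝ)
    (x : Fin D → ℝ) : ℝ :=
  (2 * Real.pi) ^ (-(D : ℝ) / 2) * C.det ^ (-(1 : ℝ) / 2) *
    Real.exp (-(1 / 2) * ((x - μ) ⬝ᵥ C⁻¹.mulVec (x - μ)))

open MeasureTheory

theorem integrable_exp_neg_half_dotProduct (ι : Type*) [Fintype ι] :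
    Integrable fun v : ι → ℝ => Real.exp (-(1 / 2) * (v ⬝ᵥ v)) := by
  have h := Integrable.fintype_prod (μ := fun _ : ι => (volume : Measure ℝ))
    (f := fun _ x => Real.exp (-(1 / 2) * x ^ 2))
    fun _ => integrable_exp_neg_mul_sq (by norm_num)
  refine h.congr (.of_forall fun v => ?_)
  dsimp only
  rw [← Real.exp_sum, dotProduct, Finset.mul_sum]
  simp only [sq]

theorem integral_exp_neg_half_dotProduct (ι : Type*) [Fintype ι] :
    ∫ v : ι → ℝ, Real.exp (-(1 / 2) * (v ⬝ᵥ v)) = (2 * π) ^ ((Fintype.card ι : ℝ) / 2) := by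
  have h := integral_fintype_prod_volume_eq_pow (ι := ι)
    (fun x : ℝ => Real.exp (-(1 / 2) * x ^ 2))
  rw [integral_gaussian, Real.sqrt_eq_rpow, ← Real.rpow_mul_natCast (by positivity)] at h
  simp_rw [dotProduct, Finset.mul_sum, Real.exp_sum, ← sq]
  rw [h, div_div_eq_mul_div, div_one, mul_comm π, one_div_mul_eq_div]

theorem integrable_exp_neg_half_dotProduct_smul (ι : Type*) [Fintype ι] :
    Integrable fun v : ι → ℝ => Real.exp (-(1 / 2) * (v ⬝ᵥ v)) • v := by
  classical
  refine Integrable.of_eval fun i => ?_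
  have h := Integrable.fintype_prod (μ := fun _ : ι => (volume : Measure ℝ))
    (f := fun j x => (if j = i then x else 1) * Real.exp (-(1 / 2) * x ^ 2)) fun j => by
      by_cases hj : j = i
      · simpa [hj] using integrable_mul_exp_neg_mul_sq (b := 1 / 2) (by norm_num)
      · simpa [hj] using integrable_exp_neg_mul_sq (b := 1 / 2) (by norm_num)
  refine h.congr (.of_forall fun v => ?_)
  dsimp only
  rw [Finset.prod_mul_distrib, ← Real.exp_sum, Finset.prod_ite_eq' Finset.univ i v,
    if_pos (Finset.mem_univ i), Pi.smul_apply, smul_eq_mul, mul_comm, dotProduct, Finset.mul_sum]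
  simp only [sq]

theorem measurableEmbedding_toLin' {ι : Type*} [Fintype ι] [DecidableEq ι] {L : Matrix ι ι ℝ}
    (hL : L.det ≠ 0) : MeasurableEmbedding (Matrix.toLin' L) := by
  refine (LinearMap.continuous_of_finiteDimensional _).measurableEmbedding ?_
  exact Matrix.mulVec_injective_iff_isUnit.2 ((Matrix.isUnit_iff_isUnit_det L).2 hL.isUnit)

theorem integrable_comp_mulVec {ι E : Type*} [Fintype ι] [DecidableEq ι] [NormedAddCommGroup E]
    {L : Matrix ι ι ℝ} (hL : L.det ≠ 0) {f : (ι → ℝ) → E} (hf : Integrable f) :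
    Integrable fun u => f (L *ᵥ u) := by
  have h : Integrable f (Measure.map (Matrix.toLin' L) volume) := by
    rw [Real.map_matrix_volume_pi_eq_smul_volume_pi hL]
    exact hf.smul_measure ENNReal.ofReal_ne_top
  exact (measurableEmbedding_toLin' hL).integrable_map_iff.1 h

theorem integral_comp_mulVec {ι E : Type*} [Fintype ι] [DecidableEq ι] [NormedAddCommGroup E]
    [NormedSpace ℝ E] {L : Matrix ι ι ℝ} (hL : L.det ≠ 0) (f : (ι → ℝ) → E) :
    ∫ u, f (L *ᵥ u) = |L.det⁻¹| • ∫ v, f v := by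
  have h := (measurableEmbedding_toLin' hL).integral_map (μ := volume) f
  rw [Real.map_matrix_volume_pi_eq_smul_volume_pi hL, integral_smul_measure,
    ENNReal.toReal_ofReal (abs_nonneg _)] at h
  simpa using h.symm

open scoped MatrixOrder in
theorem Matrix.PosDef.exists_transpose_mul_self {ι : Type*} [Fintype ι] [DecidableEq ι]
    {A : Matrix ι ι ℝ} (hA : A.PosDef) : ∃ L : Matrix ι ι ℝ, L.det ≠ 0 ∧ A = Lᵀ * L := by
  obtain ⟨L, hL, h⟩ := CStarAlgebra.isStrictlyPositive_iff_eq_star_mul_self.1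
    (Matrix.isStrictlyPositive_iff_posDef.2 hA)
  refine ⟨L, ((Matrix.isUnit_iff_isUnit_det L).1 hL).ne_zero, ?_⟩
  rwa [Matrix.star_eq_conjTranspose, Matrix.conjTranspose_eq_transpose_of_trivial] at h

section GaussDensity

variable {D : ℕ} {C : Matrix (Fin D) (Fin D) ℝ}

theorem gaussDensity_eq_gaussDensity_zero (μ : Fin D → ℝ) (C : Matrix (Fin D) (Fin D) ℝ)
    (t : Fin D → ℝ) : gaussDensity μ C t = gaussDensity 0 C (t - μ) := by
  simp [gaussDensity]

theorem gaussDensity_zero_eq {L : Matrix (Fin D) (Fin D) ℝ} (h : C⁻¹ = Lᵀ * L) (u : Fin D → ℝ) :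
    gaussDensity 0 C u = ((2 * π) ^ (-(D : ℝ) / 2) * C.det ^ (-(1 : ℝ) / 2)) *
      Real.exp (-(1 / 2) * ((L *ᵥ u) ⬝ᵥ (L *ᵥ u))) := by
  rw [gaussDensity, h, sub_zero, ← Matrix.mulVec_mulVec, Matrix.dotProduct_mulVec,
    Matrix.vecMul_transpose]

theorem integrable_gaussDensity_zero (hC : C.PosDef) : Integrable (gaussDensity 0 C) := by
  obtain ⟨L, hL, h⟩ := hC.inv.exists_transpose_mul_self
  rw [funext (gaussDensity_zero_eq h)]
  exact (integrable_comp_mulVec hL (integrable_exp_neg_half_dotProduct (Fin D))).const_mul _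

theorem integrable_gaussDensity_zero_smul (hC : C.PosDef) :
    Integrable fun u => gaussDensity 0 C u • u := by
  obtain ⟨L, hL, h⟩ := hC.inv.exists_transpose_mul_self
  have h1 := ((Matrix.toLin' L⁻¹).toContinuousLinearMap.integrable_comp
    (integrable_comp_mulVec hL (integrable_exp_neg_half_dotProduct_smul (Fin D)))).smul
      ((2 * π) ^ (-(D : ℝ) / 2) * C.det ^ (-(1 : ℝ) / 2))
  refine h1.congr (.of_forall fun u => ?_)
  simp [gaussDensity_zero_eq h, Matrix.nonsing_inv_mul _ hL.isUnit, smul_smul]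

theorem integral_gaussDensity_zero (hC : C.PosDef) : ∫ u, gaussDensity 0 C u = 1 := by
  obtain ⟨L, hL, h⟩ := hC.inv.exists_transpose_mul_self
  have hdet : C.det = |L.det⁻¹| ^ (2 : ℝ) := by
    have h1 := congrArg Matrix.det h
    rw [Matrix.det_nonsing_inv, Ring.inverse_eq_inv', Matrix.det_mul, Matrix.det_transpose] at h1
    rw [Real.rpow_two, sq_abs, ← inv_inv C.det, h1, inv_pow, sq]
  have hpos : 0 < |L.det⁻¹| := by positivity
  simp_rw [gaussDensity_zero_eq h]
  rw [integral_const_mul,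
    integral_comp_mulVec hL fun v : Fin D → ℝ => Real.exp (-(1 / 2) * (v ⬝ᵥ v)),
    integral_exp_neg_half_dotProduct, hdet, ← Real.rpow_mul hpos.le, Fintype.card_fin, neg_div,
    Real.rpow_neg (by positivity), show (2 : ℝ) * (-1 / 2) = -1 by norm_num, Real.rpow_neg_one,
    smul_eq_mul]
  have : (2 * π) ^ ((D : ℝ) / 2) ≠ 0 := by positivity
  field_simp

theorem integral_gaussDensity_zero_smul (C : Matrix (Fin D) (Fin D) ℝ) :
    ∫ u, gaussDensity 0 C u • u = 0 := by
  have h := integral_neg_eq_self (fun u => gaussDensity 0 C u • u) (volume : Measure (Fin D → ℝ))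
  have heven (u : Fin D → ℝ) : gaussDensity 0 C (-u) = gaussDensity 0 C u := by
    simp [gaussDensity, Matrix.mulVec_neg]
  simp only [heven, smul_neg, integral_neg] at h
  exact self_eq_neg.1 h.symm

theorem integral_gaussDensity (μ : Fin D → ℝ) (hC : C.PosDef) : ∫ t, gaussDensity μ C t = 1 := by
  simp_rw [gaussDensity_eq_gaussDensity_zero μ]
  rw [integral_sub_right_eq_self (gaussDensity 0 C), integral_gaussDensity_zero hC]

theorem integral_gaussDensity_smul (μ : Fin D → ℝ) (hC : C.PosDef) :
    ∫ t, gaussDensity μ C t • t = μ := by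
  rw [← integral_add_right_eq_self _ μ]
  simp_rw [gaussDensity_eq_gaussDensity_zero μ, add_sub_cancel_right, smul_add]
  rw [integral_add (integrable_gaussDensity_zero_smul hC)
    ((integrable_gaussDensity_zero hC).smul_const μ), integral_gaussDensity_zero_smul,
    integral_smul_const, integral_gaussDensity_zero hC, zero_add, one_smul]

theorem Matrix.IsHermitian.mulVec_dotProduct_comm {ι : Type*} [Fintype ι] {A : Matrix ι ι ℝ}
    (hA : A.IsHermitian) (x y : ι → ℝ) : (A *ᵥ x) ⬝ᵥ y = x ⬝ᵥ (A *ᵥ y) := by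
  have h : Aᵀ = A := by rw [← Matrix.conjTranspose_eq_transpose_of_trivial]; exact hA
  rw [Matrix.dotProduct_mulVec, ← Matrix.mulVec_transpose, h]

/-- Completing the square for a sum of two quadratic forms. -/
theorem inv_quadratic_add_inv_quadratic {ι : Type*} [Fintype ι] [DecidableEq ι]
    {A B : Matrix ι ι ℝ} (hA : A.PosDef) (hB : B.PosDef) (a b t : ι → ℝ) :
    (t - a) ⬝ᵥ A⁻¹ *ᵥ (t - a) + (t - b) ⬝ᵥ B⁻¹ *ᵥ (t - b) =
      (a - b) ⬝ᵥ (A + B)⁻¹ *ᵥ (a - b) +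
        (t - (A⁻¹ + B⁻¹)⁻¹ *ᵥ (A⁻¹ *ᵥ a + B⁻¹ *ᵥ b)) ⬝ᵥ (A⁻¹ + B⁻¹)⁻¹⁻¹ *ᵥ
          (t - (A⁻¹ + B⁻¹)⁻¹ *ᵥ (A⁻¹ *ᵥ a + B⁻¹ *ᵥ b)) := by
  have uA := hA.det_pos.ne'.isUnit
  have uB := hB.det_pos.ne'.isUnit
  have uAB := (hA.add hB).det_pos.ne'.isUnit
  have uI := (hA.inv.add hB.inv).det_pos.ne'.isUnit
  set w := (A + B)⁻¹ *ᵥ (a - b) with hw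
  set m := (A⁻¹ + B⁻¹)⁻¹ *ᵥ (A⁻¹ *ᵥ a + B⁻¹ *ᵥ b) with hm
  have hd : a - b = A *ᵥ w + B *ᵥ w := by
    rw [← Matrix.add_mulVec, hw, Matrix.mulVec_mulVec, Matrix.mul_nonsing_inv _ uAB,
      Matrix.one_mulVec]
  have hAw (v : ι → ℝ) : A⁻¹ *ᵥ (A *ᵥ v) = v := by
    rw [Matrix.mulVec_mulVec, Matrix.nonsing_inv_mul _ uA, Matrix.one_mulVec]
  have hBw (v : ι → ℝ) : B⁻¹ *ᵥ (B *ᵥ v) = v := by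
    rw [Matrix.mulVec_mulVec, Matrix.nonsing_inv_mul _ uB, Matrix.one_mulVec]
  have hb : b = a - (A *ᵥ w + B *ᵥ w) := by rw [← hd]; abel
  have hma : m = a - A *ᵥ w := by
    have h : A⁻¹ *ᵥ a + B⁻¹ *ᵥ b = (A⁻¹ + B⁻¹) *ᵥ (a - A *ᵥ w) := by
      rw [hb]
      simp only [Matrix.add_mulVec, Matrix.mulVec_sub, Matrix.mulVec_add, hAw, hBw]
      abel
    rw [hm, h, Matrix.mulVec_mulVec, Matrix.nonsing_inv_mul _ uI, Matrix.one_mulVec]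
  have hta : t - a = (t - m) - A *ᵥ w := by rw [hma]; abel
  have htb : t - b = (t - m) + B *ᵥ w := by rw [hma, hb]; abel
  rw [hd, hta, htb, Matrix.nonsing_inv_nonsing_inv _ uI]
  generalize t - m = x
  simp only [Matrix.add_mulVec, Matrix.mulVec_sub, Matrix.mulVec_add, hAw, hBw, sub_dotProduct,
    add_dotProduct, dotProduct_sub, dotProduct_add, hA.isHermitian.mulVec_dotProduct_comm w,
    hB.isHermitian.mulVec_dotProduct_comm w, Matrix.mul_nonsing_inv _ uA,
    Matrix.mul_nonsing_inv _ uB, Matrix.mulVec_mulVec, Matrix.one_mulVec, dotProduct_comm w x]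
  ring

theorem Matrix.PosDef.det_add_mul_det_inv_add_inv {ι : Type*} [Fintype ι] [DecidableEq ι]
    {A B : Matrix ι ι ℝ} (hA : A.PosDef) (hB : B.PosDef) :
    (A + B).det * (A⁻¹ + B⁻¹)⁻¹.det = A.det * B.det := by
  have uA := hA.det_pos.ne'.isUnit
  have uB := hB.det_pos.ne'.isUnit
  have h : A + B = A * (A⁻¹ + B⁻¹) * B := by
    rw [mul_add, add_mul, Matrix.mul_nonsing_inv _ uA, one_mul, mul_assoc,
      Matrix.nonsing_inv_mul _ uB, mul_one, add_comm]
  have hI := (hA.inv.add hB.inv).det_pos.ne'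
  rw [h, Matrix.det_mul, Matrix.det_mul, Matrix.det_nonsing_inv, Ring.inverse_eq_inv']
  field_simp

/-- The product of two Gaussian densities is a multiple of a Gaussian density. -/
theorem gaussDensity_mul_gaussDensity {A B : Matrix (Fin D) (Fin D) ℝ} (hA : A.PosDef)
    (hB : B.PosDef) (a b t : Fin D → ℝ) :
    gaussDensity a A t * gaussDensity b B t = gaussDensity b (A + B) a *
      gaussDensity ((A⁻¹ + B⁻¹)⁻¹ *ᵥ (A⁻¹ *ᵥ a + B⁻¹ *ᵥ b)) (A⁻¹ + B⁻¹)⁻¹ t := by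
  have hdet : A.det ^ (-(1 : ℝ) / 2) * B.det ^ (-(1 : ℝ) / 2) =
      (A + B).det ^ (-(1 : ℝ) / 2) * (A⁻¹ + B⁻¹)⁻¹.det ^ (-(1 : ℝ) / 2) := by
    rw [← Real.mul_rpow hA.det_pos.le hB.det_pos.le,
      ← Real.mul_rpow (hA.add hB).det_pos.le (hA.inv.add hB.inv).inv.det_pos.le,
      hA.det_add_mul_det_inv_add_inv hB]
  have hexp := congrArg (fun x => Real.exp (-(1 / 2) * x))
    (inv_quadratic_add_inv_quadratic hA hB a b t)
  simp only [mul_add (-(1 / 2) : ℝ), Real.exp_add] at hexp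
  simp only [gaussDensity]
  linear_combination ((2 * π) ^ (-(D : ℝ) / 2)) ^ 2 *
    (Real.exp (-(1 / 2) * ((t - a) ⬝ᵥ A⁻¹ *ᵥ (t - a))) *
      Real.exp (-(1 / 2) * ((t - b) ⬝ᵥ B⁻¹ *ᵥ (t - b))) * hdet +
      (A + B).det ^ (-(1 : ℝ) / 2) * (A⁻¹ + B⁻¹)⁻¹.det ^ (-(1 : ℝ) / 2) * hexp)

end GaussDensity

/-- First-moment rows of the Jacobian of continuous softmax attention:
for `p = N(·; μ, Σ)` and `ψ = N(·; μⱼ, Σⱼ)`, `cov_p(t, ψ(t)) = s̃ (μ̃ − μ)`. -/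
theorem stmt_17 (D : ℕ)
    (C Cj : Matrix (Fin D) (Fin D) ℝ) (hC : C.PosDef) (hCj : Cj.PosDef)
    (μ μj : Fin D → ℝ)
    (st : ℝ) (hst : st = gaussDensity μj (C + Cj) μ)
    (Ct : Matrix (Fin D) (Fin D) ℝ) (hCt : Ct = (C⁻¹ + Cj⁻¹)⁻¹)
    (mt : Fin D → ℝ) (hmt : mt = Ct.mulVec (C⁻¹.mulVec μ + Cj⁻¹.mulVec μj)) :
    (∫ t : Fin D → ℝ, (gaussDensity μ C t * gaussDensity μj Cj t) • t) -
        (∫ t : Fin D → ℝ, gaussDensity μ C t * gaussDensity μj Cj t) •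
          (∫ t : Fin D → ℝ, gaussDensity μ C t • t) =
      st • (mt - μ) := by
  subst hst hCt hmt
  have hCt := (hC.inv.add hCj.inv).inv
  simp_rw [gaussDensity_mul_gaussDensity hC hCj, mul_smul]
  rw [integral_smul, integral_const_mul, integral_gaussDensity_smul _ hCt,
    integral_gaussDensity _ hCt, integral_gaussDensity_smul _ hC, mul_one, smul_sub]
end
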